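/- arXiv:2309.03428 — 3 statements merged into one kernel-verified Lean document; each statement's English description precedes it below -/
import Mathlib

section
/- A skew-adjoint endomorphism X of ℝ⁷ satisfies X ⋄ α = 0 if and only if X(U₁) ⊆ U₁, X(U₂) ⊆ U₂, and X e₇ = 0, where U₁ = span{e₁,e₂,e₃} and U₂ = span{e₄,e₅,e₆}. -/
open scoped RealInnerProductSpace

/-- The action `X ⋄ α` of a (skew-adjoint) endomorphism `X` on an alternating `k`-form `α`:
`(X ⋄ α)(v₁,…,v_k) = −∑ᵢ α(v₁,…,X vᵢ,…,v_k)`. -/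
noncomputable def diamond {V : Type} [NormedAddCommGroup V] [InnerProductSpace ℝ V]
    {k : ℕ} (X : V →ₗ[ℝ] V) (α : AlternatingMap ℝ V ℝ (Fin k)) : (Fin k → V) → ℝ :=
  fun v => -∑ i, α (Function.update v i (X (v i)))

/-- The wedge `e^{f 1} ∧ ⋯ ∧ e^{f k}` of coordinate covectors on `ℝⁿ`, given by
`(e^{f 1} ∧ ⋯ ∧ e^{f k})(v₁,…,v_k) = det [vᵢ(f j)]`. -/
noncomputable def coordWedge {n k : ℕ} (f : Fin k → Fin n) :
    AlternatingMap ℝ (EuclideanSpace ℝ (Fin n)) ℝ (Fin k) :=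
  (Matrix.detRowAlternating (R := ℝ) (n := Fin k)).compLinearMap
    (LinearMap.pi fun j =>
      (EuclideanSpace.proj (f j) : EuclideanSpace ℝ (Fin n) →L[ℝ] ℝ).toLinearMap)

/-- The standard basis vector `eᵢ` of `ℝⁿ` (index starting at `0`). -/
noncomputable def stdE {n : ℕ} (i : Fin n) : EuclideanSpace ℝ (Fin n) :=
  EuclideanSpace.single i 1

/-- The double point calibration `α = e¹∧e²∧e³ + e⁴∧e⁵∧e⁶` on `ℝ⁷`. -/
noncomputable def alphaDP : AlternatingMap ℝ (EuclideanSpace ℝ (Fin 7)) ℝ (Fin 3) :=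
  coordWedge ![0, 1, 2] + coordWedge ![3, 4, 5]

/-- Membership in a coordinate subspace is the vanishing of the remaining coordinates. -/
theorem mem_span_stdE_image_iff {n : ℕ} (s : Set (Fin n)) (v : EuclideanSpace ℝ (Fin n)) :
    v ∈ Submodule.span ℝ (stdE '' s) ↔ ∀ i ∉ s, v i = 0 := by
  have h : (stdE : Fin n → EuclideanSpace ℝ (Fin n)) =
      (EuclideanSpace.basisFun (Fin n) ℝ).toBasis := by
    ext i : 1
    simp [stdE]
  rw [h, Module.Basis.mem_span_image]
  simp only [Set.subset_def, Finset.mem_coe, Finsupp.mem_support_iff,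
    OrthonormalBasis.coe_toBasis_repr_apply, EuclideanSpace.basisFun_repr]
  exact forall_congr' fun i => not_imp_comm

theorem mem_span_stdE_zero_one_two_iff (v : EuclideanSpace ℝ (Fin 7)) :
    v ∈ Submodule.span ℝ {stdE 0, stdE 1, stdE 2} ↔ v 3 = 0 ∧ v 4 = 0 ∧ v 5 = 0 ∧ v 6 = 0 := by
  have h := mem_span_stdE_image_iff {0, 1, 2} v
  simp only [Set.image_insert_eq, Set.image_singleton] at h
  rw [h]
  simp [Fin.forall_fin_succ]

theorem mem_span_stdE_three_four_five_iff (v : EuclideanSpace ℝ (Fin 7)) :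
    v ∈ Submodule.span ℝ {stdE 3, stdE 4, stdE 5} ↔ v 0 = 0 ∧ v 1 = 0 ∧ v 2 = 0 ∧ v 6 = 0 := by
  have h := mem_span_stdE_image_iff {3, 4, 5} v
  simp only [Set.image_insert_eq, Set.image_singleton] at h
  rw [h]
  simp [Fin.forall_fin_succ]

theorem coordWedge_apply {n k : ℕ} (f : Fin k → Fin n) (v : Fin k → EuclideanSpace ℝ (Fin n)) :
    coordWedge f v = Matrix.det (Matrix.of fun i j => v i (f j)) := rfl

theorem apply_eq_sum_stdE {n : ℕ} (X : EuclideanSpace ℝ (Fin n) →ₗ[ℝ] EuclideanSpace ℝ (Fin n))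
    (v : EuclideanSpace ℝ (Fin n)) (i : Fin n) : X v i = ∑ j, v j * X (stdE j) i := by
  have h : v = ∑ j, v j • stdE j := by
    ext i
    simp [stdE, Pi.single_apply]
  conv_lhs => rw [h]
  simp

/-- The matrix of a skew-adjoint endomorphism is skew-symmetric. -/
theorem stdE_apply_eq_neg {n : ℕ} {X : EuclideanSpace ℝ (Fin n) →ₗ[ℝ] EuclideanSpace ℝ (Fin n)}
    (hX : LinearMap.adjoint X = -X) (i j : Fin n) : X (stdE j) i = -X (stdE i) j := by
  have h := LinearMap.adjoint_inner_left X (stdE j) (stdE i)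
  rw [hX] at h
  simp [stdE, EuclideanSpace.inner_single_left, EuclideanSpace.inner_single_right] at h
  simp only [stdE]
  linarith

theorem diamond_alphaDP_apply
    (X : EuclideanSpace ℝ (Fin 7) →ₗ[ℝ] EuclideanSpace ℝ (Fin 7))
    (u v w : EuclideanSpace ℝ (Fin 7)) :
    diamond X alphaDP ![u, v, w] =
      -(alphaDP ![X u, v, w] + alphaDP ![u, X v, w] + alphaDP ![u, v, X w]) := by
  have h₀ : Function.update ![u, v, w] 0 (X u) = ![X u, v, w] := by
    ext i : 1; fin_cases i <;> rfl
  have h₁ : Function.update ![u, v, w] 1 (X v) = ![u, X v, w] := by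
    ext i : 1; fin_cases i <;> rfl
  have h₂ : Function.update ![u, v, w] 2 (X w) = ![u, v, X w] := by
    ext i : 1; fin_cases i <;> rfl
  simp [diamond, Fin.sum_univ_three, h₀, h₁, h₂]

theorem alphaDP_apply (u v w : EuclideanSpace ℝ (Fin 7)) :
    alphaDP ![u, v, w] =
      (u 0 * v 1 * w 2 - u 0 * v 2 * w 1 - u 1 * v 0 * w 2 + u 1 * v 2 * w 0
        + u 2 * v 0 * w 1 - u 2 * v 1 * w 0) +
      (u 3 * v 4 * w 5 - u 3 * v 5 * w 4 - u 4 * v 3 * w 5 + u 4 * v 5 * w 3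
        + u 5 * v 3 * w 4 - u 5 * v 4 * w 3) := by
  simp [alphaDP, coordWedge_apply, Matrix.det_fin_three]

/-- A skew-adjoint endomorphism `X` of `ℝ⁷` satisfies `X ⋄ α = 0` iff it preserves
`U₁ = span{e₁,e₂,e₃}` and `U₂ = span{e₄,e₅,e₆}` and kills `e₇`. -/
theorem diamond_alphaDP_eq_zero_iff
    (X : EuclideanSpace ℝ (Fin 7) →ₗ[ℝ] EuclideanSpace ℝ (Fin 7))
    (hX : LinearMap.adjoint X = -X) :
    diamond X alphaDP = 0 ↔
      (∀ v ∈ Submodule.span ℝ ({stdE 0, stdE 1, stdE 2} :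
          Set (EuclideanSpace ℝ (Fin 7))), X v ∈ Submodule.span ℝ ({stdE 0, stdE 1, stdE 2} :
          Set (EuclideanSpace ℝ (Fin 7)))) ∧
      (∀ v ∈ Submodule.span ℝ ({stdE 3, stdE 4, stdE 5} :
          Set (EuclideanSpace ℝ (Fin 7))), X v ∈ Submodule.span ℝ ({stdE 3, stdE 4, stdE 5} :
          Set (EuclideanSpace ℝ (Fin 7)))) ∧
      X (stdE 6) = 0 := by
  have skew := stdE_apply_eq_neg hX
  have diag (i : Fin 7) : X (stdE i) i = 0 := by linarith [skew i i]
  simp only [mem_span_stdE_zero_one_two_iff, mem_span_stdE_three_four_five_iff]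
  constructor
  · intro h
    have key (i j k : Fin 7) := (diamond_alphaDP_apply X (stdE i) (stdE j) (stdE k)).symm.trans
      (congrFun h _)
    have first (m : Fin 7) (hm : m ∈ ({3, 4, 5, 6} : Finset (Fin 7))) :
        X (stdE m) 0 = 0 ∧ X (stdE m) 1 = 0 ∧ X (stdE m) 2 = 0 := by
      have h₀ := key 1 2 m
      have h₁ := key 0 2 m
      have h₂ := key 0 1 m
      fin_cases hm <;> simp [alphaDP_apply, stdE] at h₀ h₁ h₂ <;> exact ⟨h₀, h₁, h₂⟩
    have second : X (stdE 6) 3 = 0 ∧ X (stdE 6) 4 = 0 ∧ X (stdE 6) 5 = 0 := by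
      have h₃ := key 4 5 6
      have h₄ := key 3 5 6
      have h₅ := key 3 4 6
      simp [alphaDP_apply, stdE] at h₃ h₄ h₅
      exact ⟨h₃, h₄, h₅⟩
    obtain ⟨a₃, b₃, c₃⟩ := first 3 (by decide)
    obtain ⟨a₄, b₄, c₄⟩ := first 4 (by decide)
    obtain ⟨a₅, b₅, c₅⟩ := first 5 (by decide)
    obtain ⟨a₆, b₆, c₆⟩ := first 6 (by decide)
    obtain ⟨d₆, e₆, f₆⟩ := second
    refine ⟨fun v hv => ?_, fun v hv => ?_, ?_⟩
    · obtain ⟨h₃, h₄, h₅, h₆⟩ := hv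
      refine ⟨?_, ?_, ?_, ?_⟩ <;> rw [apply_eq_sum_stdE] <;>
        simp [Fin.sum_univ_seven, h₃, h₄, h₅, h₆, skew _ 0, skew _ 1, skew _ 2, a₃, b₃, c₃, a₄, b₄, c₄,
          a₅, b₅, c₅, a₆, b₆, c₆]
    · obtain ⟨h₀, h₁, h₂, h₆⟩ := hv
      refine ⟨?_, ?_, ?_, ?_⟩ <;> rw [apply_eq_sum_stdE] <;>
        simp [Fin.sum_univ_seven, h₀, h₁, h₂, h₆, skew 6 3, skew 6 4, skew 6 5, a₃, b₃, c₃,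
          a₄, b₄, c₄, a₅, b₅, c₅, d₆, e₆, f₆]
    · ext i
      fin_cases i <;> simp [a₆, b₆, c₆, d₆, e₆, f₆, diag]
  · rintro ⟨h₁, h₂, h₃⟩
    have e₀ := h₁ (stdE 0) (by simp [stdE])
    have e₁ := h₁ (stdE 1) (by simp [stdE])
    have e₂ := h₁ (stdE 2) (by simp [stdE])
    have e₃ := h₂ (stdE 3) (by simp [stdE])
    have e₄ := h₂ (stdE 4) (by simp [stdE])
    have e₅ := h₂ (stdE 5) (by simp [stdE])
    have x₀ (v) : X v 0 = v 1 * X (stdE 1) 0 + v 2 * X (stdE 2) 0 := by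
      simp [apply_eq_sum_stdE X v, Fin.sum_univ_seven, diag, h₃, e₃, e₄, e₅]
    have x₁ (v) : X v 1 = -v 0 * X (stdE 1) 0 + v 2 * X (stdE 2) 1 := by
      simp [apply_eq_sum_stdE X v, Fin.sum_univ_seven, skew 1 0, diag, h₃, e₃, e₄, e₅]
    have x₂ (v) : X v 2 = -v 0 * X (stdE 2) 0 - v 1 * X (stdE 2) 1 := by
      simp [apply_eq_sum_stdE X v, Fin.sum_univ_seven, skew 2 0, skew 2 1, diag, h₃, e₃, e₄, e₅]
      ring
    have x₃ (v) : X v 3 = v 4 * X (stdE 4) 3 + v 5 * X (stdE 5) 3 := by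
      simp [apply_eq_sum_stdE X v, Fin.sum_univ_seven, diag, h₃, e₀, e₁, e₂]
    have x₄ (v) : X v 4 = -v 3 * X (stdE 4) 3 + v 5 * X (stdE 5) 4 := by
      simp [apply_eq_sum_stdE X v, Fin.sum_univ_seven, skew 4 3, diag, h₃, e₀, e₁, e₂]
    have x₅ (v) : X v 5 = -v 3 * X (stdE 5) 3 - v 4 * X (stdE 5) 4 := by
      simp [apply_eq_sum_stdE X v, Fin.sum_univ_seven, skew 5 3, skew 5 4, diag, h₃, e₀, e₁, e₂]
      ring
    generalize X (stdE 1) 0 = a at x₀ x₁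
    generalize X (stdE 2) 0 = b at x₀ x₂
    generalize X (stdE 2) 1 = c at x₁ x₂
    generalize X (stdE 4) 3 = p at x₃ x₄
    generalize X (stdE 5) 3 = q at x₃ x₅
    generalize X (stdE 5) 4 = r at x₄ x₅
    ext v
    have hv : v = ![v 0, v 1, v 2] := by
      ext i : 1; fin_cases i <;> rfl
    rw [hv, diamond_alphaDP_apply]
    simp only [alphaDP_apply, x₀, x₁, x₂, x₃, x₄, x₅, Pi.zero_apply]
    ring
end

section
/- Let V be a finite-dimensional real inner product space with an orthogonal complex structure J (a linear isometry with J∘J = −id), let W be a finite-dimensional J-invariant subspace of V, and let A : W × W → V be a symmetric bilinear map satisfying A(u, J v) = J(A(u,v)) for all u, v ∈ W. Then for every orthonormal basis (e₁,…,e_d) of W one has ∑_{i=1}^d A(eᵢ, eᵢ) = 0. (An infinitesimally Kähler-calibrated submanifold is minimal.) -/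
/-- The trace of a bilinear map does not depend on the choice of orthonormal basis. -/
theorem OrthonormalBasis.sum_bilinear_eq {E F ι κ : Type*} [NormedAddCommGroup E]
    [InnerProductSpace ℝ E] [FiniteDimensional ℝ E] [AddCommGroup F] [Module ℝ F]
    [Fintype ι] [Fintype κ] (A : E →ₗ[ℝ] E →ₗ[ℝ] F)
    (b : OrthonormalBasis ι ℝ E) (c : OrthonormalBasis κ ℝ E) :
    ∑ i, A (b i) (b i) = ∑ j, A (c j) (c j) := by
  have h := (InnerProductSpace.canonicalCovariantTensor_eq_sum E b).symm.trans
    (InnerProductSpace.canonicalCovariantTensor_eq_sum E c)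
  simpa using congrArg (TensorProduct.lift A) h

/-- Let `J` be an orthogonal complex structure on a finite-dimensional real inner product
space `V`, let `W` be a `J`-invariant subspace, and let `A : W × W → V` be a symmetric
bilinear map with `A(u, Jv) = J(A(u,v))`.  Then the trace of `A` with respect to any
orthonormal basis of `W` vanishes: an infinitesimally Kähler-calibrated submanifold is
minimal. -/
theorem infinitesimally_kahler_minimal {V : Type} [NormedAddCommGroup V]
    [InnerProductSpace ℝ V] [FiniteDimensional ℝ V]
    (J : V →ₗᵢ[ℝ] V) (hJ : ∀ v, J (J v) = -v)
    (W : Submodule ℝ V) (hJW : ∀ w ∈ W, J w ∈ W)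
    (A : W →ₗ[ℝ] W →ₗ[ℝ] V)
    (hsym : ∀ u v : W, A u v = A v u)
    (hJA : ∀ u v : W, A u ⟨J v, hJW v v.2⟩ = J (A u v))
    {d : ℕ} (b : OrthonormalBasis (Fin d) ℝ W) :
    ∑ i, A (b i) (b i) = 0 := by
  let K : W →ₗᵢ[ℝ] W :=
    { toLinearMap := J.toLinearMap.restrict hJW
      norm_map' := fun w => J.norm_map w }
  have hK (u v : W) : A u (K v) = J (A u v) := hJA u v
  have hneg (u : W) : A (K u) (K u) = -A u u := by
    rw [hK, hsym, hK, hJ]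
  have h := b.sum_bilinear_eq A (b.map (K.toLinearIsometryEquiv rfl))
  simp only [OrthonormalBasis.map_apply, LinearIsometry.coe_toLinearIsometryEquiv, hneg,
    Finset.sum_neg_distrib] at h
  have := IsAddTorsionFree.of_isTorsionFree ℝ V
  exact self_eq_neg.mp h
end

section
/- Let W = span{e₁,e₂,e₃} ⊆ ℝ⁷ and let A : W × W → W⊥ be a symmetric bilinear map with values in the orthogonal complement W⊥, satisfying the derivation property A(u, v×w) = (A(u,v))×w + v×(A(u,w)) for all u, v, w ∈ W. Then for every orthonormal basis (f₁, f₂, f₃) of W one has A(f₁,f₁) + A(f₂,f₂) + A(f₃,f₃) = 0. (An infinitesimally associative submanifold is minimal.) -/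
open scoped RealInnerProductSpace

/-- The associative 3-form `φ = e¹∧e²∧e³ − e¹∧e⁴∧e⁵ − e¹∧e⁶∧e⁷ − e²∧e⁴∧e⁶ − e²∧e⁷∧e⁵
− e³∧e⁴∧e⁷ − e³∧e⁵∧e⁶` on `ℝ⁷` (indices shifted down by one). -/
noncomputable def assocForm : AlternatingMap ℝ (EuclideanSpace ℝ (Fin 7)) ℝ (Fin 3) :=
  coordWedge ![0, 1, 2] - coordWedge ![0, 3, 4] - coordWedge ![0, 5, 6]
    - coordWedge ![1, 3, 5] - coordWedge ![1, 6, 4]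
    - coordWedge ![2, 3, 6] - coordWedge ![2, 4, 5]

/-- The standard associative plane `W = span{e₁,e₂,e₃} ⊆ ℝ⁷`. -/
noncomputable def Wassoc : Submodule ℝ (EuclideanSpace ℝ (Fin 7)) :=
  Submodule.span ℝ ({stdE 0, stdE 1, stdE 2} : Set (EuclideanSpace ℝ (Fin 7)))

/-- The trace of a bilinear map is the same in every orthonormal basis. -/
theorem OrthonormalBasis.sum_apply_self_eq {E F ι κ : Type*} [NormedAddCommGroup E]
    [InnerProductSpace ℝ E] [FiniteDimensional ℝ E] [AddCommGroup F] [Module ℝ F]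
    [Fintype ι] [Fintype κ]
    (B : E →ₗ[ℝ] E →ₗ[ℝ] F) (b : OrthonormalBasis ι ℝ E) (c : OrthonormalBasis κ ℝ E) :
    ∑ i, B (b i) (b i) = ∑ j, B (c j) (c j) := by
  have h := (InnerProductSpace.canonicalCovariantTensor_eq_sum E b).symm.trans
    (InnerProductSpace.canonicalCovariantTensor_eq_sum E c)
  simpa using congrArg (TensorProduct.lift B) h

theorem coordWedge_three_apply {n : ℕ} (i j k : Fin n) (u v w : EuclideanSpace ℝ (Fin n)) :
    coordWedge ![i, j, k] ![u, v, w] =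
      u i * v j * w k - u i * v k * w j - u j * v i * w k + u j * v k * w i
        + u k * v i * w j - u k * v j * w i := by
  change Matrix.det (Matrix.of fun a b : Fin 3 => (![u, v, w] a) (![i, j, k] b)) = _
  simp [Matrix.det_fin_three]

section AssociativePlane

theorem stdE_mem_Wassoc (i : Fin 3) : stdE (Fin.castLE (by decide) i) ∈ Wassoc :=
  Submodule.subset_span (by fin_cases i <;> simp)

/-- The orthonormal basis `e₁, e₂, e₃` of the associative plane. -/
noncomputable def stdBasisWassoc : OrthonormalBasis (Fin 3) ℝ Wassoc :=
  OrthonormalBasis.mk (v := fun i => ⟨stdE (Fin.castLE (by decide) i), stdE_mem_Wassoc i⟩)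
    (by
      rw [orthonormal_iff_ite]
      intro i j
      simp [stdE, EuclideanSpace.inner_single_left])
    (by
      rw [top_le_iff, ← Submodule.map_injective_of_injective Wassoc.injective_subtype |>.eq_iff,
        Submodule.map_span, Submodule.map_subtype_top, ← Set.range_comp]
      refine congrArg (Submodule.span ℝ) ?_
      ext x
      simp [Fin.exists_fin_succ, eq_comm])

theorem coe_stdBasisWassoc (i : Fin 3) :
    (stdBasisWassoc i : EuclideanSpace ℝ (Fin 7)) = stdE (Fin.castLE (by decide) i) := by
  simp [stdBasisWassoc]

variable {cross : EuclideanSpace ℝ (Fin 7) → EuclideanSpace ℝ (Fin 7) → EuclideanSpace ℝ (Fin 7)}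

theorem assocCross_anticomm
    (hcross : ∀ u v w : EuclideanSpace ℝ (Fin 7), ⟪cross u v, w⟫ = assocForm ![u, v, w])
    (u v : EuclideanSpace ℝ (Fin 7)) : cross u v = -cross v u := by
  refine ext_inner_right ℝ fun w => ?_
  rw [inner_neg_left, hcross, hcross]
  simp only [assocForm, AlternatingMap.sub_apply, coordWedge_three_apply]
  ring

/-- The associative plane carries the cyclic multiplication table of the cross product. -/
theorem assocCross_stdBasisWassoc
    (hcross : ∀ u v w : EuclideanSpace ℝ (Fin 7), ⟪cross u v, w⟫ = assocForm ![u, v, w])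
    (i : Fin 3) :
    cross (stdBasisWassoc (i + 1)) (stdBasisWassoc (i + 2)) = stdBasisWassoc i := by
  refine ext_inner_right ℝ fun w => ?_
  rw [hcross]
  simp only [assocForm, AlternatingMap.sub_apply, coordWedge_three_apply, coe_stdBasisWassoc]
  fin_cases i <;> simp [stdE, EuclideanSpace.inner_single_left]

end AssociativePlane

/-- Let `×` be the cross product on `ℝ⁷` determined by `⟨u×v, w⟩ = φ(u,v,w)`, and let
`A : W × W → W⊥` be a symmetric bilinear map satisfying the derivation property
`A(u, v×w) = (A(u,v))×w + v×(A(u,w))`.  Then the trace of `A` with respect to any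
orthonormal basis of `W` vanishes: an infinitesimally associative submanifold is minimal. -/
theorem infinitesimally_assoc_minimal
    (cross : EuclideanSpace ℝ (Fin 7) → EuclideanSpace ℝ (Fin 7) → EuclideanSpace ℝ (Fin 7))
    (hcross : ∀ u v w : EuclideanSpace ℝ (Fin 7),
      inner (𝕜 := ℝ) (cross u v) w = assocForm ![u, v, w])
    (A : Wassoc →ₗ[ℝ] Wassoc →ₗ[ℝ] EuclideanSpace ℝ (Fin 7))
    (hrange : ∀ u v : Wassoc, A u v ∈ Wassocᗮ)
    (hsym : ∀ u v : Wassoc, A u v = A v u)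
    (hder : ∀ u v w : Wassoc, ∀ h : cross ↑v ↑w ∈ Wassoc,
      A u ⟨cross ↑v ↑w, h⟩ = cross (A u v) ↑w + cross ↑v (A u w))
    (b : OrthonormalBasis (Fin 3) ℝ Wassoc) :
    ∑ i, A (b i) (b i) = 0 := by
  have hdiag (i : Fin 3) : A (stdBasisWassoc i) (stdBasisWassoc i) =
      cross (A (stdBasisWassoc i) (stdBasisWassoc (i + 1))) (stdBasisWassoc (i + 2)) +
        cross (stdBasisWassoc (i + 1)) (A (stdBasisWassoc i) (stdBasisWassoc (i + 2))) := by
    have h := assocCross_stdBasisWassoc hcross i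
    rw [← hder _ _ _ (h ▸ (stdBasisWassoc i).2)]
    congr 1
    exact Subtype.ext h.symm
  rw [b.sum_apply_self_eq A stdBasisWassoc, Fin.sum_univ_three, hdiag 0, hdiag 1, hdiag 2]
  simp only [Fin.isValue, zero_add, Fin.reduceAdd]
  rw [hsym (stdBasisWassoc 1) (stdBasisWassoc 0), hsym (stdBasisWassoc 2) (stdBasisWassoc 0),
    hsym (stdBasisWassoc 2) (stdBasisWassoc 1),
    assocCross_anticomm hcross (stdBasisWassoc 1), assocCross_anticomm hcross (stdBasisWassoc 2),
    assocCross_anticomm hcross (stdBasisWassoc 0)]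
  abel
end
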